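/- Let F : ℝ^{m×n} → ℝ^{m×n} be Lipschitz continuous (with respect to the Frobenius norm). Let A : [0, h] → ℝ^{m×n} be differentiable with A′(t) = F(A(t)) for all t ∈ [0, h]. Let Q ∈ ℝ^{m×k₁} and W ∈ ℝ^{n×k₂} have orthonormal columns (QᵀQ = I, WᵀW = I), and assume that for every t ∈ [0, h] the column space of A(t) is contained in the column space of Q and the column space of A(t)ᵀ is contained in the column space of W. Let B : [0, h] → ℝ^{m×k₂}, C : [0, h] → ℝ^{n×k₁}, D : [0, h] → ℝ^{k₁×k₂} be differentiable curves with B′(t) = F(B(t) Wᵀ) W, B(0) = A(0) W; C′(t) = F(Q C(t)ᵀ)ᵀ Q, C(0) = A(0)ᵀ Q; D′(t) = Qᵀ F(Q D(t) Wᵀ) W, D(0) = Qᵀ A(0) W. Then B(h) = A(h) W, C(h) = A(h)ᵀ Q, D(h) = Qᵀ A(h) W, and for any matrix Y ∈ ℝ^{k₂×k₁} satisfying D(h) Y D(h) = D(h), one has B(h) Y C(h)ᵀ = A(h). -/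

import Mathlib

open Matrix

attribute [local instance] Matrix.frobeniusNormedAddCommGroup Matrix.frobeniusNormedSpace

/-- Uniqueness for projected differential equations: if `P` recovers `A t` from `L (A t)`, then
the solution of `X' = L (F (P X))` starting from `L (A 0)` is `L ∘ A`. -/
theorem eq_apply_of_hasDerivAt_projected {E V : Type*} [NormedAddCommGroup E] [NormedSpace ℝ E]
    [NormedAddCommGroup V] [NormedSpace ℝ V] {h : ℝ} (hh : 0 ≤ h) {F : E → E} {Λ : ℝ}
    (hΛ : 0 ≤ Λ) (hF : ∀ X Y, ‖F X - F Y‖ ≤ Λ * ‖X - Y‖) {A : ℝ → E}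
    (hA : ∀ t ∈ Set.Icc (0 : ℝ) h, HasDerivAt A (F (A t)) t) (L : E →L[ℝ] V) (P : V →L[ℝ] E)
    (hPL : ∀ t ∈ Set.Icc (0 : ℝ) h, P (L (A t)) = A t) {X : ℝ → V}
    (hX : ∀ t ∈ Set.Icc (0 : ℝ) h, HasDerivAt X (L (F (P (X t)))) t) (hX0 : X 0 = L (A 0)) :
    X h = L (A h) := by
  have hF' : LipschitzWith Λ.toNNReal F := LipschitzWith.of_dist_le_mul fun X Y => by
    simpa only [dist_eq_norm, Real.coe_toNNReal Λ hΛ] using hF X Y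
  have hLA : ∀ t ∈ Set.Icc (0 : ℝ) h,
      HasDerivAt (fun s => L (A s)) (L (F (P (L (A t))))) t := fun t ht => by
    rw [hPL t ht]
    exact L.hasFDerivAt.comp_hasDerivAt t (hA t ht)
  exact ODE_solution_unique (v := fun _ Z => L (F (P Z)))
    (fun _ => (L.lipschitz.comp (hF'.comp P.lipschitz)))
    (fun t ht => (hX t ht).continuousAt.continuousWithinAt)
    (fun t ht => (hX t (Set.Ico_subset_Icc_self ht)).hasDerivWithinAt)
    (fun t ht => (hLA t ht).continuousAt.continuousWithinAt)
    (fun t ht => (hLA t (Set.Ico_subset_Icc_self ht)).hasDerivWithinAt)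
    hX0 (Set.right_mem_Icc.2 hh)

/-- If `Q` has orthonormal columns and its column space contains that of `M`, then the orthogonal
projection `Q * Qᵀ` fixes `M`. -/
theorem mul_transpose_mul_eq_of_range_le {m n k : Type*} [Fintype m] [Fintype n] [Fintype k]
    [DecidableEq n] [DecidableEq k] {Q : Matrix m k ℝ} {M : Matrix m n ℝ} (hQ : Qᵀ * Q = 1)
    (hM : LinearMap.range M.mulVecLin ≤ LinearMap.range Q.mulVecLin) : Q * Qᵀ * M = M := by
  refine Matrix.ext_of_mulVec_single fun i => ?_
  obtain ⟨u, hu⟩ := hM ⟨Pi.single i 1, rfl⟩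
  simp only [Matrix.mulVecLin_apply] at hu
  rw [← Matrix.mulVec_mulVec, ← hu, Matrix.mulVec_mulVec, Matrix.mul_assoc, hQ, Matrix.mul_one]

/-- Exactness property of the dynamical generalized Nyström method: under a Lipschitz
vector field `F` (Frobenius norm), with `A′(t) = F(A(t))`, orthonormal `Q`, `W` whose
column spaces contain the column space of `A(t)` and of `A(t)ᵀ` respectively for all
`t ∈ [0, h]`, the solutions of the B-, C- and D-steps satisfy `B(h) = A(h) W`,
`C(h) = A(h)ᵀ Q`, `D(h) = Qᵀ A(h) W`, and for any inner generalized inverse `Y` of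
`D(h)` one has `B(h) Y C(h)ᵀ = A(h)`. -/
theorem stmt_15 {m n k₁ k₂ : ℕ} {h : ℝ} (hh : 0 ≤ h)
    (F : Matrix (Fin m) (Fin n) ℝ → Matrix (Fin m) (Fin n) ℝ)
    (Λ : ℝ) (hΛ : 0 ≤ Λ)
    (hF : ∀ X Y : Matrix (Fin m) (Fin n) ℝ, ‖F X - F Y‖ ≤ Λ * ‖X - Y‖)
    (A : ℝ → Matrix (Fin m) (Fin n) ℝ)
    (Q : Matrix (Fin m) (Fin k₁) ℝ) (W : Matrix (Fin n) (Fin k₂) ℝ)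
    (hQ : Qᵀ * Q = 1) (hW : Wᵀ * W = 1)
    (hA : ∀ t ∈ Set.Icc (0 : ℝ) h, HasDerivAt A (F (A t)) t)
    (hrange : ∀ t ∈ Set.Icc (0 : ℝ) h,
      LinearMap.range (A t).mulVecLin ≤ LinearMap.range Q.mulVecLin)
    (hcorange : ∀ t ∈ Set.Icc (0 : ℝ) h,
      LinearMap.range (A t)ᵀ.mulVecLin ≤ LinearMap.range W.mulVecLin)
    (B : ℝ → Matrix (Fin m) (Fin k₂) ℝ)
    (C : ℝ → Matrix (Fin n) (Fin k₁) ℝ)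
    (D : ℝ → Matrix (Fin k₁) (Fin k₂) ℝ)
    (hB : ∀ t ∈ Set.Icc (0 : ℝ) h, HasDerivAt B (F (B t * Wᵀ) * W) t)
    (hB0 : B 0 = A 0 * W)
    (hC : ∀ t ∈ Set.Icc (0 : ℝ) h, HasDerivAt C ((F (Q * (C t)ᵀ))ᵀ * Q) t)
    (hC0 : C 0 = (A 0)ᵀ * Q)
    (hD : ∀ t ∈ Set.Icc (0 : ℝ) h, HasDerivAt D (Qᵀ * F (Q * D t * Wᵀ) * W) t)
    (hD0 : D 0 = Qᵀ * A 0 * W) :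
    B h = A h * W ∧ C h = (A h)ᵀ * Q ∧ D h = Qᵀ * A h * W ∧
      ∀ Y : Matrix (Fin k₂) (Fin k₁) ℝ,
        D h * Y * D h = D h → B h * Y * (C h)ᵀ = A h := by
  have hQA : ∀ t ∈ Set.Icc (0 : ℝ) h, Q * Qᵀ * A t = A t := fun t ht =>
    mul_transpose_mul_eq_of_range_le hQ (hrange t ht)
  have hAW : ∀ t ∈ Set.Icc (0 : ℝ) h, A t * W * Wᵀ = A t := fun t ht => by
    simpa [Matrix.mul_assoc] using
      congrArg transpose (mul_transpose_mul_eq_of_range_le hW (hcorange t ht))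
  have hBh : B h = A h * W := by
    let L : Matrix (Fin m) (Fin n) ℝ →ₗ[ℝ] Matrix (Fin m) (Fin k₂) ℝ := mulRightLinearMap _ ℝ W
    let P : Matrix (Fin m) (Fin k₂) ℝ →ₗ[ℝ] Matrix (Fin m) (Fin n) ℝ := mulRightLinearMap _ ℝ Wᵀ
    exact eq_apply_of_hasDerivAt_projected hh hΛ hF hA L.toContinuousLinearMap
      P.toContinuousLinearMap hAW hB hB0
  have hCh : C h = (A h)ᵀ * Q := by
    let L : Matrix (Fin m) (Fin n) ℝ →ₗ[ℝ] Matrix (Fin n) (Fin k₁) ℝ :=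
      mulRightLinearMap _ ℝ Q ∘ₗ (transposeLinearEquiv _ _ ℝ ℝ).toLinearMap
    let P : Matrix (Fin n) (Fin k₁) ℝ →ₗ[ℝ] Matrix (Fin m) (Fin n) ℝ :=
      mulLeftLinearMap _ ℝ Q ∘ₗ (transposeLinearEquiv _ _ ℝ ℝ).toLinearMap
    refine eq_apply_of_hasDerivAt_projected hh hΛ hF hA L.toContinuousLinearMap
      P.toContinuousLinearMap (fun t ht => ?_) hC hC0
    change Q * ((A t)ᵀ * Q)ᵀ = A t
    rw [transpose_mul, transpose_transpose, ← Matrix.mul_assoc, hQA t ht]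
  have hDh : D h = Qᵀ * A h * W := by
    let L : Matrix (Fin m) (Fin n) ℝ →ₗ[ℝ] Matrix (Fin k₁) (Fin k₂) ℝ :=
      mulRightLinearMap _ ℝ W ∘ₗ mulLeftLinearMap _ ℝ Qᵀ
    let P : Matrix (Fin k₁) (Fin k₂) ℝ →ₗ[ℝ] Matrix (Fin m) (Fin n) ℝ :=
      mulRightLinearMap _ ℝ Wᵀ ∘ₗ mulLeftLinearMap _ ℝ Q
    refine eq_apply_of_hasDerivAt_projected hh hΛ hF hA L.toContinuousLinearMap
      P.toContinuousLinearMap (fun t ht => ?_) hD hD0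
    change Q * (Qᵀ * A t * W) * Wᵀ = A t
    rw [← Matrix.mul_assoc, ← Matrix.mul_assoc, hQA t ht, hAW t ht]
  refine ⟨hBh, hCh, hDh, fun Y hY => ?_⟩
  have hmem : h ∈ Set.Icc (0 : ℝ) h := Set.right_mem_Icc.2 hh
  have hBD : B h = Q * D h := by
    rw [hBh, hDh, ← Matrix.mul_assoc, ← Matrix.mul_assoc, hQA h hmem]
  have hCD : (C h)ᵀ = D h * Wᵀ := by
    rw [hCh, hDh, transpose_mul, transpose_transpose, Matrix.mul_assoc, Matrix.mul_assoc,
      ← Matrix.mul_assoc (A h), hAW h hmem]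
  calc B h * Y * (C h)ᵀ = Q * (D h * Y * D h) * Wᵀ := by
        rw [hBD, hCD]; simp only [Matrix.mul_assoc]
    _ = A h := by rw [hY, ← hBD, hBh, hAW h hmem]
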